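/- There is a universal constant C such that for every n ≥ 1, every d ≥ 1, every multilinear real polynomial P on R^n of total degree at most d with P not identically zero, and every δ with 0 < δ < 1, the function f = sign(P) satisfies GNS_δ(f) ≤ C^d · δ^{1/(2d+1)}. -/

import Mathlib

open Finset MeasureTheory ProbabilityTheory
open scoped Classical

noncomputable section

/-- The ±1 real value of a Boolean bit (`true ↦ 1`, `false ↦ -1`). -/
def pmOne (b : Bool) : ℝ := if b then 1 else -1

/-- Noise sensitivity at rate `δ` of a Boolean function on the hypercube `{-1,1}^n`:
`Pr[f(X) ≠ f(Z)]` where `X` is uniform and `Z` flips each coordinate of `X`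
independently with probability `δ`. -/
def noiseSens {n : ℕ} (δ : ℝ) (f : (Fin n → Bool) → Bool) : ℝ :=
  (1 / 2 ^ n : ℝ) * ∑ x : Fin n → Bool, ∑ s : Fin n → Bool,
    (∏ i, if s i then δ else 1 - δ) * (if f x ≠ f (fun i => xor (s i) (x i)) then 1 else 0)

/-- Influence of the `i`-th variable: `Pr[f(X) ≠ f(X^{(i)})]`. -/
def influence {n : ℕ} (f : (Fin n → Bool) → Bool) (i : Fin n) : ℝ :=
  (1 / 2 ^ n : ℝ) * ∑ x : Fin n → Bool,
    if f x ≠ f (Function.update x i (!x i)) then 1 else 0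

/-- Average sensitivity (total influence). -/
def avgSens {n : ℕ} (f : (Fin n → Bool) → Bool) : ℝ := ∑ i, influence f i

/-- `f` is a degree-`d` polynomial threshold function: `f = sign(P)` for some real
polynomial of total degree at most `d`, with the convention `sign 0 = 1`. -/
def IsPTF {n : ℕ} (d : ℕ) (f : (Fin n → Bool) → Bool) : Prop :=
  ∃ P : MvPolynomial (Fin n) ℝ, P.totalDegree ≤ d ∧
    ∀ x, (f x = true ↔ 0 ≤ MvPolynomial.eval (fun i => pmOne (x i)) P)

/-- Evaluation of the multilinear polynomial with coefficients `a` at the point `x`. -/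
def mlEval {n : ℕ} (a : Finset (Fin n) → ℝ) (x : Fin n → ℝ) : ℝ :=
  ∑ I : Finset (Fin n), a I * ∏ i ∈ I, x i

/-- The multilinear polynomial with coefficients `a` has degree at most `d`. -/
def DegLE {n : ℕ} (a : Finset (Fin n) → ℝ) (d : ℕ) : Prop :=
  ∀ I, a I ≠ 0 → I.card ≤ d

/-- Squared weight `w_i²` of coordinate `i`: `Σ_{I ∋ i} a_I²`. -/
def wsq {n : ℕ} (a : Finset (Fin n) → ℝ) (i : Fin n) : ℝ :=
  ∑ I ∈ univ.filter (fun I : Finset (Fin n) => i ∈ I), a I ^ 2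

/-- `ε`-regularity: `Σ_i w_i⁴ ≤ ε² (Σ_i w_i²)²`. -/
def Regular {n : ℕ} (a : Finset (Fin n) → ℝ) (ε : ℝ) : Prop :=
  ∑ i, wsq a i ^ 2 ≤ ε ^ 2 * (∑ i, wsq a i) ^ 2

/-- `σ_{k+1}²(P) = Σ_{j ≥ k (0-based)} w_j²` (tail weight, `k` restricted variables). -/
def sigmaSq {n : ℕ} (a : Finset (Fin n) → ℝ) (k : ℕ) : ℝ :=
  ∑ j ∈ univ.filter (fun j : Fin n => k ≤ (j : ℕ)), wsq a j

/-- The variables are ordered by decreasing weight. -/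
def OrderedWeights {n : ℕ} (a : Finset (Fin n) → ℝ) : Prop :=
  ∀ i j : Fin n, i ≤ j → wsq a j ≤ wsq a i

/-- The `ε`-critical index `K(P,ε)`: least `k` such that `w_j² ≤ ε² σ_{k+1}²` for all
`j` beyond the first `k` variables. -/
def critIndex {n : ℕ} (a : Finset (Fin n) → ℝ) (ε : ℝ) : ℕ :=
  sInf {k : ℕ | ∀ j : Fin n, k ≤ (j : ℕ) → wsq a j ≤ ε ^ 2 * sigmaSq a k}

/-- Coefficients (in the variables `Y_j`, `j ≥ K`) of the restriction of the multilinear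
polynomial `a` obtained by fixing the first `K` variables to `x`. -/
def restCoeff {n : ℕ} (a : Finset (Fin n) → ℝ) (K : ℕ) (x : Fin n → ℝ)
    (J : Finset (Fin n)) : ℝ :=
  if ∀ j ∈ J, K ≤ (j : ℕ) then
    ∑ I ∈ univ.filter (fun I : Finset (Fin n) => I.filter (fun i => K ≤ i.val) = J),
      a I * ∏ i ∈ I.filter (fun i => i.val < K), x i
  else 0

/-- Standard Gaussian measure on `ℝ^n`. -/
def gaussn (n : ℕ) : Measure (Fin n → ℝ) := Measure.pi fun _ => gaussianReal 0 1

/-- Gaussian noise sensitivity: `Pr[f(X) ≠ f((1-δ)X + √(2δ-δ²)Y)]` for independent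
standard Gaussian vectors `X, Y`. -/
def gns (n : ℕ) (δ : ℝ) (f : (Fin n → ℝ) → ℝ) : ℝ :=
  (((gaussn n).prod (gaussn n))
    {p | f p.1 ≠ f (fun i => (1 - δ) * p.1 i + Real.sqrt (2 * δ - δ ^ 2) * p.2 i)}).toReal

/-- Normalized probabilists' Hermite polynomial `H_k(x)`. -/
def normHermite (k : ℕ) (x : ℝ) : ℝ :=
  Polynomial.aeval x (Polynomial.hermite k) / Real.sqrt (Nat.factorial k)


open Polynomial in
lemma Polynomial.card_sign_changes_le_natDegree (Q : ℝ[X]) (t : ℕ → ℝ) (M : ℕ)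
    (ht : ∀ i j, i < j → j < 2 * M → t i < t j) :
    #{j ∈ range M | ¬(0 ≤ Q.eval (t (2 * j)) ↔ 0 ≤ Q.eval (t (2 * j + 1)))} ≤ Q.natDegree := by
  rcases eq_or_ne Q 0 with rfl | hQ
  · simp
  have hroot : ∀ j ∈ ({j ∈ range M | ¬(0 ≤ Q.eval (t (2 * j)) ↔
      0 ≤ Q.eval (t (2 * j + 1)))} : Finset ℕ),
      ∃ r ∈ Set.Icc (t (2 * j)) (t (2 * j + 1)), Q.eval r = 0 := by
    intro j hj
    rw [mem_filter, mem_range] at hj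
    have hle := (ht (2 * j) (2 * j + 1) (by omega) (by omega)).le
    have hc : ContinuousOn (fun x => Q.eval x) (Set.Icc (t (2 * j)) (t (2 * j + 1))) :=
      Q.continuous.continuousOn
    by_cases h : 0 ≤ Q.eval (t (2 * j))
    · exact intermediate_value_Icc' hle hc ⟨by by_contra! h'; exact hj.2 (by simp [h, h'.le]), h⟩
    · exact intermediate_value_Icc hle hc
        ⟨(not_le.1 h).le, by by_contra! h'; exact hj.2 (by simp [h, h'])⟩
  choose! r hr hr0 using hroot
  have hlt : ∀ i ∈ ({j ∈ range M | ¬(0 ≤ Q.eval (t (2 * j)) ↔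
      0 ≤ Q.eval (t (2 * j + 1)))} : Finset ℕ), ∀ j ∈ ({j ∈ range M |
      ¬(0 ≤ Q.eval (t (2 * j)) ↔ 0 ≤ Q.eval (t (2 * j + 1)))} : Finset ℕ),
      i < j → r i < r j := fun i hi j hj hij => by
    have hjM := mem_range.1 (mem_filter.1 hj).1
    exact (hr i hi).2.trans_lt ((ht _ _ (by omega) (by omega)).trans_le (hr j hj).1)
  refine (card_le_card_of_injOn r (t := Q.roots.toFinset) (fun j hj => ?_)
    (fun i hi j hj hij => ?_)).trans ((Multiset.toFinset_card_le _).trans Q.card_roots')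
  · simpa [hQ] using hr0 j hj
  · rcases lt_trichotomy i j with h | h | h
    · exact absurd hij (hlt i hi j hj h).ne
    · exact h
    · exact absurd hij (hlt j hj i hi h).ne'

lemma one_sub_tan_half_sq {φ : ℝ} (h0 : 0 ≤ φ) (h1 : φ < Real.pi) :
    1 - Real.tan (φ / 2) ^ 2 = (1 + Real.tan (φ / 2) ^ 2) * Real.cos φ := by
  have hc : Real.cos (φ / 2) ≠ 0 := (Real.cos_pos_of_mem_Ioo ⟨by linarith, by linarith⟩).ne'
  have h2 : φ = 2 * (φ / 2) := by ring
  have := Real.sin_sq_add_cos_sq (φ / 2)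
  conv_rhs => rw [h2, Real.cos_two_mul, ← h2]
  rw [Real.tan_eq_sin_div_cos]
  field_simp
  rw [show Real.sin (φ / 2) ^ 2 = 1 - Real.cos (φ / 2) ^ 2 by linarith]
  ring

lemma two_mul_tan_half {φ : ℝ} (h0 : 0 ≤ φ) (h1 : φ < Real.pi) :
    2 * Real.tan (φ / 2) = (1 + Real.tan (φ / 2) ^ 2) * Real.sin φ := by
  have hc : Real.cos (φ / 2) ≠ 0 := (Real.cos_pos_of_mem_Ioo ⟨by linarith, by linarith⟩).ne'
  have h2 : φ = 2 * (φ / 2) := by ring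
  have := Real.sin_sq_add_cos_sq (φ / 2)
  conv_rhs => rw [h2, Real.sin_two_mul, ← h2]
  rw [Real.tan_eq_sin_div_cos]
  field_simp
  rw [add_comm, this, mul_one]

open Polynomial in
/-- On a circle, a polynomial of degree at most `d` becomes, in the half-angle parameter and up to
a positive factor, a univariate polynomial of degree at most `2 * d`. -/
lemma exists_polynomial_eval_tan_half {n d : ℕ} {a : Finset (Fin n) → ℝ} (ha : DegLE a d)
    (x y : Fin n → ℝ) :
    ∃ Q : ℝ[X], Q.natDegree ≤ 2 * d ∧ ∀ φ, 0 ≤ φ → φ < Real.pi →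
      Q.eval (Real.tan (φ / 2)) = (1 + Real.tan (φ / 2) ^ 2) ^ d *
        mlEval a (fun i => Real.cos φ * x i + Real.sin φ * y i) := by
  refine ⟨∑ I, C (a I) * (1 + X ^ 2) ^ (d - #I) *
    ∏ i ∈ I, ((1 - X ^ 2) * C (x i) + 2 * X * C (y i)), ?_, fun φ h0 h1 => ?_⟩
  · refine natDegree_sum_le_of_forall_le _ _ fun I _ => ?_
    by_cases hI : a I = 0
    · simp [hI]
    have hprod : (∏ i ∈ I, ((1 - X ^ 2) * C (x i) + 2 * X * C (y i)) : ℝ[X]).natDegree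
        ≤ 2 * #I := by
      refine (natDegree_prod_le _ _).trans ((sum_le_card_nsmul _ _ 2 fun i _ => ?_).trans ?_)
      · rw [show (2 : ℝ[X]) = C 2 from rfl]
        compute_degree
      · simp [mul_comm]
    have hpow : (C (a I) * (1 + X ^ 2) ^ (d - #I) : ℝ[X]).natDegree ≤ (d - #I) * 2 :=
      (natDegree_C_mul_le _ _).trans (natDegree_pow_le_of_le _ (by compute_degree))
    have := ha I hI
    exact (natDegree_mul_le_of_le hpow hprod).trans (by omega)
  · simp only [mlEval, eval_finsetSum, mul_sum, eval_mul, eval_C, eval_pow, eval_add, eval_one,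
      eval_X, eval_prod, eval_sub, eval_ofNat]
    refine sum_congr rfl fun I _ => ?_
    by_cases hI : a I = 0
    · simp [hI]
    have hfac : ∀ i, (1 - Real.tan (φ / 2) ^ 2) * x i + 2 * Real.tan (φ / 2) * y i =
        (1 + Real.tan (φ / 2) ^ 2) * (Real.cos φ * x i + Real.sin φ * y i) := fun i => by
      rw [one_sub_tan_half_sq h0 h1, two_mul_tan_half h0 h1]
      ring
    simp only [hfac, prod_mul_distrib, prod_const]
    rw [← Nat.sub_add_cancel (ha I hI), pow_add, Nat.add_sub_cancel]
    ring

lemma card_sign_changes_circle_le {n d : ℕ} {a : Finset (Fin n) → ℝ} (ha : DegLE a d)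
    (x y : Fin n → ℝ) {θ : ℝ} (hθ : 0 < θ) (M : ℕ) (hM : (2 * M - 1) * θ < Real.pi) :
    #((range M).filter fun j : ℕ =>
      ¬(0 ≤ mlEval a (fun i => Real.cos (2 * j * θ) * x i + Real.sin (2 * j * θ) * y i) ↔
        0 ≤ mlEval a (fun i => Real.cos (2 * j * θ + θ) * x i + Real.sin (2 * j * θ + θ) * y i)))
      ≤ 2 * d := by
  obtain ⟨Q, hQd, hQ⟩ := exists_polynomial_eval_tan_half ha x y
  have hlt : ∀ j : ℕ, j < 2 * M → (j : ℝ) * θ < Real.pi := fun j hj => by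
    have : (j : ℝ) + 1 ≤ 2 * M := by exact_mod_cast hj
    nlinarith
  have hsign : ∀ φ, 0 ≤ φ → φ < Real.pi → (0 ≤ Q.eval (Real.tan (φ / 2)) ↔
      0 ≤ mlEval a (fun i => Real.cos φ * x i + Real.sin φ * y i)) := fun φ h0 h1 => by
    rw [hQ φ h0 h1, mul_nonneg_iff_of_pos_left (by positivity)]
  refine le_trans (le_of_eq ?_) ((Q.card_sign_changes_le_natDegree
    (fun j => Real.tan (j * θ / 2)) M fun i j hij hj => ?_).trans hQd)
  · congr 1
    refine filter_congr fun j hj => ?_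
    rw [mem_range] at hj
    have h1 := hsign _ (by positivity) (hlt (2 * j) (by omega))
    have h2 := hsign _ (by positivity) (hlt (2 * j + 1) (by omega))
    rw [h1, h2]
    push_cast
    rw [add_mul, one_mul]
  · have hij' : (i : ℝ) < j := by exact_mod_cast hij
    have := hlt j hj
    have hi : 0 ≤ (i : ℝ) * θ := by positivity
    exact Real.tan_lt_tan_of_lt_of_lt_pi_div_two (by linarith [Real.pi_pos]) (by linarith)
      (by nlinarith)

lemma sum_measure_le_of_card_le {Ω : Type*} [MeasurableSpace Ω] (μ : Measure Ω)
    [IsProbabilityMeasure μ] {ι : Type*} (s : Finset ι) (A : ι → Set Ω)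
    (hA : ∀ j ∈ s, MeasurableSet (A j)) (m : ℕ) (hm : ∀ p, #{j ∈ s | p ∈ A j} ≤ m) :
    ∑ j ∈ s, μ (A j) ≤ m := by
  calc ∑ j ∈ s, μ (A j) = ∑ j ∈ s, ∫⁻ p, (A j).indicator 1 p ∂μ :=
        sum_congr rfl fun j hj => (lintegral_indicator_one (hA j hj)).symm
    _ = ∫⁻ p, ∑ j ∈ s, (A j).indicator 1 p ∂μ :=
        (lintegral_finsetSum' _ fun j hj => (measurable_one.indicator (hA j hj)).aemeasurable).symm
    _ ≤ ∫⁻ _, (m : ENNReal) ∂μ := by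
        refine lintegral_mono fun p => ?_
        simp only [Set.indicator_apply, Pi.one_apply, sum_boole]
        exact_mod_cast hm p
    _ = m := by simp

instance isProbabilityMeasure_gaussn (n : ℕ) : IsProbabilityMeasure (gaussn n) := by
  unfold gaussn
  infer_instance

instance isGaussian_gaussn (n : ℕ) : IsGaussian (gaussn n) := by
  have h : gaussn n = (stdGaussian (EuclideanSpace ℝ (Fin n))).map
      (EuclideanSpace.equiv (Fin n) ℝ).toContinuousLinearMap := by
    rw [← map_pi_eq_stdGaussian, Measure.map_map (by fun_prop) (by fun_prop)]
    exact Measure.map_id.symm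
  rw [h]
  infer_instance

lemma map_rotation_gaussn (n : ℕ) (φ : ℝ) :
    ((gaussn n).prod (gaussn n)).map (ContinuousLinearMap.rotation φ) =
      (gaussn n).prod (gaussn n) := by
  refine IsGaussian.map_rotation_eq_self ?_ φ
  ext i
  rw [eval_integral fun i => (IsGaussian.integrable_id (μ := gaussn n)).eval i]
  exact (integral_comp_eval (μ := fun _ : Fin n => gaussianReal 0 1) (i := i) (f := id)
    (by fun_prop)).trans integral_id_gaussianReal

lemma measurable_mlEval {n : ℕ} (a : Finset (Fin n) → ℝ) : Measurable (mlEval a) := by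
  unfold mlEval
  fun_prop

lemma measure_sign_change_circle_eq {n : ℕ} (a : Finset (Fin n) → ℝ) (θ φ : ℝ) :
    ((gaussn n).prod (gaussn n)) {p |
      ¬(0 ≤ mlEval a (fun i => Real.cos φ * p.1 i + Real.sin φ * p.2 i) ↔
        0 ≤ mlEval a (fun i => Real.cos (φ + θ) * p.1 i + Real.sin (φ + θ) * p.2 i))} =
    ((gaussn n).prod (gaussn n)) {p | ¬(0 ≤ mlEval a p.1 ↔
        0 ≤ mlEval a (fun i => Real.cos θ * p.1 i + Real.sin θ * p.2 i))} := by
  have hmeas := measurable_mlEval a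
  conv_rhs => rw [← map_rotation_gaussn n φ]
  rw [Measure.map_apply (by fun_prop)]
  · congr 1
    ext p
    simp only [Set.mem_ofPred_eq, Set.mem_preimage, ContinuousLinearMap.rotation_apply]
    have h : ∀ i, Real.cos (φ + θ) * p.1 i + Real.sin (φ + θ) * p.2 i =
        Real.cos θ * (Real.cos φ • p.1 + Real.sin φ • p.2) i +
          Real.sin θ * (-Real.sin φ • p.1 + Real.cos φ • p.2) i := fun i => by
      simp only [Real.cos_add, Real.sin_add, Pi.add_apply, Pi.smul_apply, smul_eq_mul]
      ring
    simp only [h]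
    rfl
  · refine MeasurableSet.compl (MeasurableSet.iff ?_ ?_)
    · exact measurableSet_le measurable_const (by fun_prop)
    · exact measurableSet_le measurable_const (by fun_prop)

/-- Averaging over a rotation orbit bounds the probability that the sign of a polynomial of degree
`d` changes under rotation by an angle `θ`. -/
lemma measure_sign_change_rotation_le {n d : ℕ} (hd : 1 ≤ d) {a : Finset (Fin n) → ℝ}
    (ha : DegLE a d) {θ : ℝ} (hθ : 0 < θ) :
    ((gaussn n).prod (gaussn n)).real {p | ¬(0 ≤ mlEval a p.1 ↔
        0 ≤ mlEval a (fun i => Real.cos θ * p.1 i + Real.sin θ * p.2 i))} ≤ 2 * d * θ := by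
  have hd' : (1 : ℝ) ≤ d := by exact_mod_cast hd
  rcases le_or_gt 1 θ with h1 | h1
  · exact measureReal_le_one.trans (by nlinarith)
  set M : ℕ := ⌊1 / θ⌋₊ + 1 with hM
  have hMl : 1 / θ ≤ M := by
    rw [hM]; push_cast; exact (Nat.lt_floor_add_one _).le
  have hMu : (M : ℝ) ≤ 1 / θ + 1 := by
    rw [hM]; push_cast; gcongr; exact Nat.floor_le (by positivity)
  have hMlt : (2 * M - 1) * θ < Real.pi := by
    have : M * θ ≤ 1 + θ := by
      calc M * θ ≤ (1 / θ + 1) * θ := by gcongr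
        _ = 1 + θ := by field_simp
    linarith [Real.pi_gt_three]
  have hmeas := measurable_mlEval a
  have hsum := sum_measure_le_of_card_le ((gaussn n).prod (gaussn n)) (range M) (fun j => {p |
      ¬(0 ≤ mlEval a (fun i => Real.cos (2 * j * θ) * p.1 i + Real.sin (2 * j * θ) * p.2 i) ↔
        0 ≤ mlEval a (fun i => Real.cos (2 * j * θ + θ) * p.1 i +
          Real.sin (2 * j * θ + θ) * p.2 i))})
    (fun j _ => MeasurableSet.compl (MeasurableSet.iff
      (measurableSet_le measurable_const (by fun_prop))
      (measurableSet_le measurable_const (by fun_prop))))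
    (2 * d) (fun p => by
      simpa only [Set.mem_ofPred_eq] using card_sign_changes_circle_le ha p.1 p.2 hθ M hMlt)
  simp only [measure_sign_change_circle_eq, sum_const, card_range, nsmul_eq_mul] at hsum
  have hreal := ENNReal.toReal_mono (ENNReal.natCast_ne_top _) hsum
  rw [ENNReal.toReal_mul, ENNReal.toReal_natCast, ENNReal.toReal_natCast, ← measureReal_def]
    at hreal
  push_cast at hreal
  refine le_of_mul_le_mul_left (a := 1 / θ) ?_ (by positivity)
  calc _ ≤ _ := mul_le_mul_of_nonneg_right hMl measureReal_nonneg
    _ ≤ 2 * (d : ℝ) := hreal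
    _ = 1 / θ * (2 * d * θ) := by field_simp

lemma arccos_one_sub_le {δ : ℝ} (h0 : 0 ≤ δ) (h1 : δ ≤ 1) :
    Real.arccos (1 - δ) ≤ 3 * √δ := by
  have hle : |Real.arccos (1 - δ)| ≤ Real.pi := by
    rw [abs_of_nonneg (Real.arccos_nonneg _)]
    exact Real.arccos_le_pi _
  have h := Real.cos_le_one_sub_mul_cos_sq hle
  rw [Real.cos_arccos (by linarith) (by linarith)] at h
  have hpi : Real.pi ^ 2 ≤ 18 := by nlinarith [Real.pi_pos, Real.pi_lt_four]
  have hsq : Real.arccos (1 - δ) ^ 2 ≤ 9 * δ := by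
    have h' : 2 * Real.arccos (1 - δ) ^ 2 / Real.pi ^ 2 ≤ δ := by
      linarith [show 2 * Real.arccos (1 - δ) ^ 2 / Real.pi ^ 2 =
        2 / Real.pi ^ 2 * Real.arccos (1 - δ) ^ 2 by ring]
    rw [div_le_iff₀ (by positivity)] at h'
    nlinarith
  refine abs_le_of_sq_le_sq' ?_ (by positivity) |>.2
  rw [mul_pow, Real.sq_sqrt h0]
  linarith

/-- Theorem 1.4: there is a universal constant `C` such that for every
nonzero multilinear polynomial `P` of degree at most `d`, the Gaussian noise sensitivity
of `f = sign(P)` satisfies `GNS_δ(f) ≤ C^d · δ^{1/(2d+1)}`. -/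
theorem gaussian_noise_sensitivity_of_multilinear_PTF :
    ∃ C : ℝ, 0 < C ∧ ∀ (n d : ℕ), 1 ≤ n → 1 ≤ d →
      ∀ a : Finset (Fin n) → ℝ, DegLE a d → (∃ I, a I ≠ 0) →
        ∀ δ : ℝ, 0 < δ → δ < 1 →
          gns n δ (fun x => if 0 ≤ mlEval a x then 1 else -1)
            ≤ C ^ d * δ ^ ((1 : ℝ) / (2 * (d : ℝ) + 1)) := by
  refine ⟨12, by norm_num, fun n d _ hd a ha _ δ h0 h1 => ?_⟩
  have hcos : Real.cos (Real.arccos (1 - δ)) = 1 - δ :=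
    Real.cos_arccos (by linarith) (by linarith)
  have hsin : Real.sin (Real.arccos (1 - δ)) = √(2 * δ - δ ^ 2) := by
    rw [Real.sin_arccos]
    ring_nf
  have hgns : gns n δ (fun x => if 0 ≤ mlEval a x then 1 else -1) ≤
      2 * d * Real.arccos (1 - δ) := by
    refine le_of_eq_of_le ?_
      (measure_sign_change_rotation_le hd ha (Real.arccos_pos.2 (by linarith)))
    rw [hcos, hsin, gns, measureReal_def]
    congr 2
    ext p
    simp only [Set.mem_ofPred_eq]
    by_cases hx : 0 ≤ mlEval a p.1 <;>
      by_cases hz : 0 ≤ mlEval a (fun i => (1 - δ) * p.1 i + √(2 * δ - δ ^ 2) * p.2 i) <;>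
      simp only [hx, hz] <;> norm_num
  have hsqrt : √δ ≤ δ ^ ((1 : ℝ) / (2 * (d : ℝ) + 1)) := by
    rw [Real.sqrt_eq_rpow]
    have : (1 : ℝ) ≤ d := by exact_mod_cast hd
    exact Real.rpow_le_rpow_of_exponent_ge h0 h1.le
      (one_div_le_one_div_of_le (by norm_num) (by linarith))
  have hconst : (6 * d : ℝ) ≤ 12 ^ d := by
    calc (6 * d : ℝ) ≤ 6 ^ d * 2 ^ d := by
          gcongr
          · exact le_self_pow₀ (by norm_num) (by omega)
          · exact_mod_cast Nat.lt_two_pow_self.le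
      _ = 12 ^ d := by rw [← mul_pow]; norm_num
  calc _ ≤ 2 * d * Real.arccos (1 - δ) := hgns
    _ ≤ 2 * d * (3 * √δ) := by gcongr; exact arccos_one_sub_le h0.le h1.le
    _ = 6 * d * √δ := by ring
    _ ≤ _ := by gcongr

end
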